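/- Let T : H → H be a bounded self-adjoint operator with t := ‖T‖ ≤ 1. Let f₊ and f₋ be orthonormal vectors in H with T f₊ = t f₊ and T f₋ = −t f₋, and suppose there is ε ∈ (0, t] such that ‖T u‖ ≤ (t − ε) ‖u‖ for every u ∈ H orthogonal to both f₊ and f₋. Then for all w, v ∈ H with ⟨f₊, w⟩ = 0, ⟨f₊, v⟩ = 0 and (1 − T) v = w, one has Re ⟨w, (t + T) v⟩ ≥ (ε/2) ‖w − ⟨f₋, w⟩ f₋‖². -/

import Mathlib

open scoped ComplexInnerProductSpace

/-- If `‖x‖ ≤ (t - ε) ‖u‖` with `0 < ε ≤ t ≤ 1`, then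
`Re ⟪u - x, t u + x⟫ ≥ (ε / 2) ‖u - x‖²`. -/
theorem half_mul_norm_sub_sq_le_re_inner {H : Type*} [NormedAddCommGroup H]
    [InnerProductSpace ℂ H] {u x : H} {t ε : ℝ} (hε : 0 < ε) (hεt : ε ≤ t) (ht : t ≤ 1)
    (hx : ‖x‖ ≤ (t - ε) * ‖u‖) :
    ε / 2 * ‖u - x‖ ^ 2 ≤ (⟪u - x, (t : ℂ) • u + x⟫).re := by
  have hsymm : (⟪x, u⟫).re = (⟪u, x⟫).re := inner_re_symm (𝕜 := ℂ) x u
  have hu : (⟪u, u⟫).re = ‖u‖ ^ 2 := (norm_sq_eq_re_inner (𝕜 := ℂ) u).symm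
  have hxx : (⟪x, x⟫).re = ‖x‖ ^ 2 := (norm_sq_eq_re_inner (𝕜 := ℂ) x).symm
  have hnorm : ‖u - x‖ ^ 2 = ‖u‖ ^ 2 - 2 * (⟪u, x⟫).re + ‖x‖ ^ 2 :=
    norm_sub_sq (𝕜 := ℂ) u x
  have hinner : (⟪u - x, (t : ℂ) • u + x⟫).re
      = t * ‖u‖ ^ 2 + (1 - t) * (⟪u, x⟫).re - ‖x‖ ^ 2 := by
    simp only [inner_sub_left, inner_add_right, inner_smul_right, Complex.sub_re, Complex.add_re,
      Complex.re_ofReal_mul, hsymm, hu, hxx]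
    ring
  have hlower : -((t - ε) * ‖u‖ ^ 2) ≤ (⟪u, x⟫).re := by
    have h₁ := (abs_le.mp ((Complex.abs_re_le_norm _).trans (norm_inner_le_norm (𝕜 := ℂ) u x))).1
    have h₂ := mul_le_mul_of_nonneg_left hx (norm_nonneg u)
    linarith
  have hsq : ‖x‖ ^ 2 ≤ (t - ε) ^ 2 * ‖u‖ ^ 2 := by
    rw [← mul_pow]
    exact pow_le_pow_left₀ (norm_nonneg x) hx 2
  have h₁ := mul_le_mul_of_nonneg_left hlower (show 0 ≤ 1 - t + ε by linarith)
  have h₂ := mul_le_mul_of_nonneg_left hsq (show 0 ≤ 1 + ε / 2 by linarith)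
  have h₃ : 0 ≤ (1 + (t - ε)) * (ε / 2 * (1 - (t - ε))) * ‖u‖ ^ 2 := by
    have : 0 ≤ 1 + (t - ε) := by linarith
    have : 0 ≤ 1 - (t - ε) := by linarith
    positivity
  rw [hnorm, hinner]
  linarith

/-- Let `T` be a bounded self-adjoint operator on a complex Hilbert space
with `t = ‖T‖ ≤ 1`, let `fp, fm` be orthonormal with `T fp = t fp`, `T fm = −t fm`, and suppose
`‖T u‖ ≤ (t − ε) ‖u‖` for all `u ⟂ fp, fm`, for some `ε ∈ (0, t]`.  Then for all `w, v` with
`⟪fp, w⟫ = 0`, `⟪fp, v⟫ = 0` and `(1 − T) v = w` one has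
`Re ⟪w, (t + T) v⟫ ≥ (ε/2) ‖w − ⟪fm, w⟫ fm‖²`. -/
theorem stmt_17 {H : Type*} [NormedAddCommGroup H] [InnerProductSpace ℂ H] [CompleteSpace H]
    (T : H →L[ℂ] H) (hT : IsSelfAdjoint T) (hT1 : ‖T‖ ≤ 1)
    (fp fm : H) (hfp : ‖fp‖ = 1) (hfm : ‖fm‖ = 1) (horth : ⟪fp, fm⟫ = 0)
    (hTfp : T fp = (‖T‖ : ℂ) • fp) (hTfm : T fm = -(‖T‖ : ℂ) • fm)
    (ε : ℝ) (hε : 0 < ε) (hεt : ε ≤ ‖T‖)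
    (hgap : ∀ u : H, ⟪fp, u⟫ = 0 → ⟪fm, u⟫ = 0 → ‖T u‖ ≤ (‖T‖ - ε) * ‖u‖) :
    ∀ w v : H, ⟪fp, w⟫ = 0 → ⟪fp, v⟫ = 0 → v - T v = w →
      ε / 2 * ‖w - ⟪fm, w⟫ • fm‖ ^ 2 ≤ (⟪w, (‖T‖ : ℂ) • v + T v⟫).re := by
  intro w v _ hv hw
  have hfm' : ⟪fm, fm⟫ = 1 := by simp [inner_self_eq_norm_sq_to_K, hfm]
  obtain ⟨a, u, hu, rfl⟩ : ∃ (a : ℂ) (u : H), ⟪fm, u⟫ = 0 ∧ v = a • fm + u :=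
    ⟨⟪fm, v⟫, v - ⟪fm, v⟫ • fm, by simp [hfm], by simp⟩
  have hup : ⟪fp, u⟫ = 0 := by
    simpa [inner_add_right, inner_smul_right, horth] using hv
  have hTu : ⟪fm, T u⟫ = 0 := by
    have h : ⟪T fm, u⟫ = ⟪fm, T u⟫ := hT.isSymmetric fm u
    rw [← h, hTfm, inner_smul_left, hu, mul_zero]
  have hw' : w = (a * (1 + ‖T‖)) • fm + (u - T u) := by
    rw [← hw, map_add, map_smul, hTfm]
    module
  have hsum : (‖T‖ : ℂ) • (a • fm + u) + T (a • fm + u) = (‖T‖ : ℂ) • u + T u := by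
    rw [map_add, map_smul, hTfm]
    module
  have hcoeff : ⟪fm, w⟫ = a * (1 + ‖T‖) := by
    rw [hw', inner_add_right, inner_smul_right, inner_sub_right, hfm', hu, hTu]
    ring
  have hproj : w - ⟪fm, w⟫ • fm = u - T u := by
    rw [hcoeff, hw', add_sub_cancel_left]
  have hinner : ⟪w, (‖T‖ : ℂ) • u + T u⟫ = ⟪u - T u, (‖T‖ : ℂ) • u + T u⟫ := by
    rw [hw', inner_add_left, inner_smul_left, inner_add_right fm, inner_smul_right, hu, hTu]
    ring
  rw [hproj, hsum, hinner]
  exact half_mul_norm_sub_sq_le_re_inner hε hεt hT1 (hgap u hup hu)
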